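/- Among all positive semidefinite d×d matrices Σ with prescribed diagonal blocks Σ₁ ∈ 𝕊^p_≥ and Σ₂ ∈ 𝕊^q_≥ (d = p+q), the matrix Σ_m with off-diagonal block Ψ_m = U₁Λ₁^{1/2}ΠΛ₂^{1/2}U₂ᵀ minimizes the von Neumann entropy −trace(Σ log Σ) = −Σ_j λ_j log λ_j, where the λ_j are the eigenvalues of Σ and 0·log 0 := 0. -/

import Mathlib

open Matrix

/-- The `p × q` upper-left block of the identity matrix. -/
def PiBlock (p q : ℕ) : Matrix (Fin p) (Fin q) ℝ :=
  Matrix.of fun i j => if (i : ℕ) = (j : ℕ) then 1 else 0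

/-- The maximal off-diagonal block `Ψ_m = U₁ Λ₁^{1/2} Π Λ₂^{1/2} U₂ᵀ`. -/
noncomputable def PsiM {p q : ℕ} (U₁ : Matrix (Fin p) (Fin p) ℝ)
    (l1 : Fin p → ℝ) (U₂ : Matrix (Fin q) (Fin q) ℝ) (l2 : Fin q → ℝ) :
    Matrix (Fin p) (Fin q) ℝ :=
  U₁ * Matrix.diagonal (fun i => Real.sqrt (l1 i)) * PiBlock p q *
    Matrix.diagonal (fun j => Real.sqrt (l2 j)) * U₂ᵀ

/-- A partitioned `(p+q) × (p+q)` matrix with given blocks, indexed by `Fin (p+q)`. -/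
def blockMat {p q : ℕ} (S₁ : Matrix (Fin p) (Fin p) ℝ) (Ψ : Matrix (Fin p) (Fin q) ℝ)
    (S₂ : Matrix (Fin q) (Fin q) ℝ) : Matrix (Fin (p + q)) (Fin (p + q)) ℝ :=
  (Matrix.fromBlocks S₁ Ψ Ψᵀ S₂).submatrix finSumFinEquiv.symm finSumFinEquiv.symm

/-- The von Neumann entropy `−∑_j λ_j log λ_j` of a Hermitian matrix (with `0 log 0 := 0`,
which is automatic since `Real.log 0 = 0`). -/
noncomputable def vonNeumannEntropy {d : ℕ} (S : Matrix (Fin d) (Fin d) ℝ)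
    (hS : S.IsHermitian) : ℝ :=
  -∑ j, hS.eigenvalues j * Real.log (hS.eigenvalues j)

/-- zero extension -/
noncomputable def extZ {n : ℕ} (f : Fin n → ℝ) (k : ℕ) : ℝ := if h : k < n then f ⟨k, h⟩ else 0

lemma extZ_nonneg {n : ℕ} {f : Fin n → ℝ} (h0 : ∀ i, 0 ≤ f i) (k : ℕ) : 0 ≤ extZ f k := by
  unfold extZ
  split_ifs
  · exact h0 _
  · exact le_rfl

lemma extZ_antitone {n : ℕ} {f : Fin n → ℝ} (hf : Antitone f) (h0 : ∀ i, 0 ≤ f i) :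
    Antitone (extZ f) := by
  intro a b hab
  unfold extZ
  split_ifs with h1 h2
  · exact hf (by simpa using hab)
  · omega
  · exact h0 _
  · exact le_rfl

lemma extZ_val {n : ℕ} (f : Fin n → ℝ) (k : Fin n) : extZ f k = f k := by
  simp [extZ]

lemma dual_exists (N : ℕ) (c l : ℕ → ℝ) (hc : Antitone c) (hl : Antitone l)
    (hc0 : ∀ k, 0 ≤ c k) (hl0 : ∀ k, 0 ≤ l k) :
    ∃ u v : ℕ → ℝ, (∀ k, 0 ≤ u k) ∧ (∀ k, k < N → 0 ≤ v k) ∧ (∀ k, u k + v k = c k * l k) ∧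
      ∀ k i, k < N → i < N → c k * l i ≤ u k + v i := by
  have up : ∀ a b, a ≤ b → l b * (c a - c b) ≤ ∑ m ∈ Finset.Ico a b, l m * (c m - c (m + 1)) ∧
      ∑ m ∈ Finset.Ico a b, l m * (c m - c (m + 1)) ≤ l a * (c a - c b) := by
    intro a b hab
    have tel : ∑ m ∈ Finset.Ico a b, (c m - c (m + 1)) = c a - c b := by
      rw [Finset.sum_Ico_eq_sum_range, ]
      have := Finset.sum_range_sub' (fun i => c (a + i)) (b - a)
      simp only [← add_assoc] at this ⊢
      rw [this]
      simp [Nat.add_sub_cancel' hab]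
    rw [← tel, Finset.mul_sum, Finset.mul_sum]
    constructor
    · apply Finset.sum_le_sum
      intro m hm
      rw [Finset.mem_Ico] at hm
      exact mul_le_mul_of_nonneg_right (hl hm.2.le) (sub_nonneg.2 (hc (Nat.le_succ m)))
    · apply Finset.sum_le_sum
      intro m hm
      rw [Finset.mem_Ico] at hm
      exact mul_le_mul_of_nonneg_right (hl hm.1) (sub_nonneg.2 (hc (Nat.le_succ m)))
  refine ⟨fun k => ∑ m ∈ Finset.Ico k N, l m * (c m - c (m + 1)),
    fun k => c k * l k - ∑ m ∈ Finset.Ico k N, l m * (c m - c (m + 1)), ?_, ?_, ?_, ?_⟩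
  · intro k
    exact Finset.sum_nonneg fun m _ => mul_nonneg (hl0 m) (sub_nonneg.2 (hc (Nat.le_succ m)))
  · intro k hk
    have := (up k N hk.le).2
    have := mul_nonneg (hl0 k) (hc0 N)
    simp only
    linarith
  · intro k
    simp
  · intro k i hk hi
    simp only
    rcases le_total k i with h | h
    · rw [← Finset.sum_Ico_consecutive _ h hi.le]
      have := (up k i h).1
      linarith
    · rw [← Finset.sum_Ico_consecutive _ h hk.le]
      have := (up i k h).2
      linarith

lemma substoch {d p : ℕ} (hpd : p ≤ d) (c : Fin d → ℝ) (l : Fin p → ℝ)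
    (hc : Antitone c) (hl : Antitone l) (hc0 : ∀ k, 0 ≤ c k) (hl0 : ∀ k, 0 ≤ l k)
    (W : Fin d → Fin p → ℝ) (hW : ∀ k i, 0 ≤ W k i) (hr : ∀ k, ∑ i, W k i ≤ 1)
    (hcol : ∀ i, ∑ k, W k i ≤ 1) :
    ∑ k, c k * ∑ i, W k i * l i ≤ ∑ k : Fin d, c k * extZ l k := by
  obtain ⟨u, v, hu, hv, huv, hcl⟩ := dual_exists d (extZ c) (extZ l) (extZ_antitone hc hc0)
    (extZ_antitone hl hl0) (extZ_nonneg hc0) (extZ_nonneg hl0)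
  calc ∑ k, c k * ∑ i, W k i * l i
      = ∑ k, ∑ i, W k i * (c k * l i) := by
        refine Finset.sum_congr rfl fun k _ => ?_
        rw [Finset.mul_sum]
        exact Finset.sum_congr rfl fun i _ => by ring
    _ ≤ ∑ k : Fin d, ∑ i : Fin p, W k i * (u k + v i) := by
        refine Finset.sum_le_sum fun k _ => Finset.sum_le_sum fun i _ => ?_
        refine mul_le_mul_of_nonneg_left ?_ (hW k i)
        have := hcl k i k.2 (i.2.trans_le hpd)
        rwa [extZ_val, extZ_val] at this
    _ = ∑ k : Fin d, (∑ i : Fin p, W k i) * u k + ∑ i : Fin p, (∑ k : Fin d, W k i) * v i := by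
        simp only [mul_add, Finset.sum_add_distrib, Finset.sum_mul]
        congr 1
        rw [Finset.sum_comm]
    _ ≤ ∑ k : Fin d, u k + ∑ i : Fin p, v i := by
        refine add_le_add (Finset.sum_le_sum fun k _ => ?_) (Finset.sum_le_sum fun i _ => ?_)
        · exact mul_le_of_le_one_left (hu k) (hr k)
        · exact mul_le_of_le_one_left (hv i (i.2.trans_le hpd)) (hcol i)
    _ ≤ ∑ k : Fin d, u k + ∑ i : Fin d, v i := by
        gcongr
        rw [Fin.sum_univ_eq_sum_range v p, Fin.sum_univ_eq_sum_range v d]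
        refine Finset.sum_le_sum_of_subset_of_nonneg (by simpa using hpd) fun i hi _ => ?_
        exact hv i (by simpa using hi)
    _ = ∑ k : Fin d, c k * extZ l k := by
        rw [← Finset.sum_add_distrib]
        refine Finset.sum_congr rfl fun k _ => ?_
        rw [huv, extZ_val]

lemma tangent {x y : ℝ} (hx : 0 < x) (hy : 0 ≤ y) :
    x * Real.log x + (Real.log x + 1) * (y - x) ≤ y * Real.log y := by
  rcases hy.eq_or_lt with rfl | hy
  · simp
    nlinarith
  · have h := Real.log_le_sub_one_of_pos (div_pos hx hy)
    rw [Real.log_div hx.ne' hy.ne'] at h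
    have h2 := mul_le_mul_of_nonneg_left h hy.le
    have : y * (x / y - 1) = x - y := by field_simp
    linarith

lemma karamata {d : ℕ} (lam mu : Fin d → ℝ) (hlam : Antitone lam) (hlam0 : ∀ k, 0 ≤ lam k)
    (hmu0 : ∀ k, 0 ≤ mu k) (hsum : ∑ k, lam k = ∑ k, mu k)
    (H : ∀ c : Fin d → ℝ, Antitone c → (∀ k, 0 ≤ c k) → ∑ k, c k * lam k ≤ ∑ k, c k * mu k) :
    ∑ k, lam k * Real.log (lam k) ≤ ∑ k, mu k * Real.log (mu k) := by
  obtain ⟨M, hM⟩ : ∃ M : ℝ, ∀ k, M ≤ Real.log (lam k) + 1 ∧ M ≤ Real.log (mu k) := by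
    obtain ⟨M1, h1⟩ := (Set.finite_range fun k => Real.log (lam k) + 1).bddBelow
    obtain ⟨M2, h2⟩ := (Set.finite_range fun k => Real.log (mu k)).bddBelow
    exact ⟨min M1 M2, fun k => ⟨(min_le_left _ _).trans (h1 ⟨k, rfl⟩),
      (min_le_right _ _).trans (h2 ⟨k, rfl⟩)⟩⟩
  let c : Fin d → ℝ := fun k => if 0 < lam k then Real.log (lam k) + 1 else M
  have hcM : ∀ k, M ≤ c k := by
    intro k
    simp only [c]
    split_ifs
    · exact (hM k).1
    · exact le_rfl
  have hc : Antitone c := by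
    intro a b hab
    have := hlam hab
    by_cases hb : 0 < lam b
    · have ha : 0 < lam a := hb.trans_le this
      simp only [c, if_pos ha, if_pos hb]
      have := Real.log_le_log hb this
      linarith
    · have : c b = M := by simp only [c, if_neg hb]
      rw [this]
      exact hcM a
  have h1 := H (fun k => c k - M) (fun a b hab => sub_le_sub_right (hc hab) M)
    (fun k => sub_nonneg.2 (hcM k))
  simp only [sub_mul, Finset.sum_sub_distrib, ← Finset.mul_sum, hsum] at h1
  have h2 : ∀ k, lam k * Real.log (lam k) + c k * (mu k - lam k) ≤ mu k * Real.log (mu k) := by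
    intro k
    by_cases hk : 0 < lam k
    · simp only [c, if_pos hk]
      exact tangent hk (hmu0 k)
    · have h0 : lam k = 0 := le_antisymm (not_lt.1 hk) (hlam0 k)
      simp only [c, if_neg hk, h0]
      have := mul_le_mul_of_nonneg_left (hM k).2 (hmu0 k)
      simp
      linarith
  have h3 := Finset.sum_le_sum fun k (_ : k ∈ Finset.univ) => h2 k
  simp only [mul_sub, Finset.sum_add_distrib, Finset.sum_sub_distrib] at h3
  linarith

/-- From `Aᵀ A = diag l` get a substochastic weight matrix. -/
lemma weights {d p : ℕ} (A : Matrix (Fin d) (Fin p) ℝ) (l : Fin p → ℝ) (hl0 : ∀ i, 0 ≤ l i)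
    (hA : Aᵀ * A = Matrix.diagonal l) :
    ∃ W : Fin d → Fin p → ℝ, (∀ k i, 0 ≤ W k i) ∧ (∀ k, ∑ i, W k i ≤ 1) ∧
      (∀ i, ∑ k, W k i ≤ 1) ∧ ∀ k i, W k i * l i = A k i ^ 2 := by
  have hcolA : ∀ i, ∑ k, A k i ^ 2 = l i := by
    intro i
    have := congrFun (congrFun hA i) i
    simp only [Matrix.mul_apply, Matrix.transpose_apply, Matrix.diagonal_apply_eq] at this
    rw [← this]
    exact Finset.sum_congr rfl fun k _ => by ring
  have hz : ∀ k i, l i = 0 → A k i = 0 := by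
    intro k i h
    have := hcolA i
    rw [h, Finset.sum_eq_zero_iff_of_nonneg (fun _ _ => sq_nonneg _)] at this
    exact pow_eq_zero_iff (two_ne_zero) |>.1 (this k (Finset.mem_univ k))
  let s : Fin p → ℝ := fun i => (Real.sqrt (l i))⁻¹
  have hs : ∀ i, s i * s i = (l i)⁻¹ := fun i => by
    simp only [s]
    rw [← mul_inv, Real.mul_self_sqrt (hl0 i)]
  let N : Matrix (Fin d) (Fin p) ℝ := A * Matrix.diagonal s
  have hN : ∀ k i, N k i = A k i * s i := fun k i => by simp [N]
  have hNN : N * (Nᵀ * N) = N := by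
    have : Nᵀ * N = Matrix.diagonal (fun i => s i * l i * s i) := by
      simp only [N, Matrix.transpose_mul, Matrix.diagonal_transpose]
      rw [Matrix.mul_assoc, ← Matrix.mul_assoc Aᵀ, hA]
      simp [Matrix.diagonal_mul_diagonal, mul_assoc]
    rw [this]
    ext k i
    rw [Matrix.mul_diagonal, hN]
    by_cases h : l i = 0
    · rw [hz k i h]; ring
    · have : s i * l i * s i = 1 := by
        rw [mul_right_comm, hs, inv_mul_cancel₀ h]
      rw [this, mul_one]
  refine ⟨fun k i => N k i ^ 2, fun k i => sq_nonneg _, ?_, ?_, ?_⟩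
  · intro k
    set P := N * Nᵀ with hP
    have hPP : P * Pᵀ = P := by
      rw [hP, Matrix.transpose_mul N Nᵀ, Matrix.transpose_transpose N, ← Matrix.mul_assoc (N * Nᵀ),
        Matrix.mul_assoc N Nᵀ N, hNN]
    have h1 : ∑ i, N k i ^ 2 = P k k := by
      simp [hP, Matrix.mul_apply, sq]
    have h2 : P k k = ∑ j, P k j ^ 2 := by
      conv_lhs => rw [← hPP]
      simp [Matrix.mul_apply, sq]
    have h3 : P k k ^ 2 ≤ P k k := by
      conv_rhs => rw [h2]
      exact Finset.single_le_sum (f := fun j => P k j ^ 2) (fun _ _ => sq_nonneg _)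
        (Finset.mem_univ k)
    rw [h1]
    nlinarith
  · intro i
    simp only [hN, mul_pow, ← Finset.sum_mul, hcolA]
    rw [sq (s i), hs]
    exact mul_inv_le_one
  · intro k i
    simp only [hN, mul_pow]
    rw [sq (s i), hs]
    by_cases h : l i = 0
    · rw [hz k i h]; ring
    · field_simp

lemma sum_extZ {d p : ℕ} (hpd : p ≤ d) (l : Fin p → ℝ) : ∑ k : Fin d, extZ l k = ∑ i, l i := by
  rw [Fin.sum_univ_eq_sum_range (extZ l) d,
    ← Finset.sum_subset (Finset.range_mono hpd), ← Fin.sum_univ_eq_sum_range (extZ l) p]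
  · simp [extZ_val]
  · intro x _ hx
    simp only [Finset.mem_range] at hx
    simp [extZ, hx]

lemma PiBlock_sq (d p : ℕ) (l : Fin p → ℝ) :
    PiBlock d p * Matrix.diagonal l * (PiBlock d p)ᵀ =
      Matrix.diagonal (fun k : Fin d => extZ l k) := by
  ext a b
  simp only [Matrix.mul_apply, Matrix.mul_diagonal, PiBlock, Matrix.of_apply,
    Matrix.transpose_apply, Matrix.diagonal_apply, extZ]
  by_cases h : (a : ℕ) < p
  · rw [Finset.sum_eq_single (⟨a, h⟩ : Fin p)]
    · by_cases hab : a = b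
      · subst hab; simp [h]
      · have : ¬ (b : ℕ) = a := fun h => hab (Fin.ext h.symm)
        simp [hab, this]
    · intro i _ hi
      have : ¬ (a : ℕ) = i := fun h => hi (Fin.ext h.symm)
      simp [this]
    · simp
  · rw [Finset.sum_eq_zero]
    · simp [h]
    · intro i _
      have : ¬ (a : ℕ) = i := by have := i.2; omega
      simp [this]

lemma PiBlock_mul {d p q : ℕ} (hp : p ≤ d) :
    (PiBlock d p)ᵀ * PiBlock d q = PiBlock p q := by
  ext a b
  simp only [Matrix.mul_apply, PiBlock, Matrix.of_apply, Matrix.transpose_apply]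
  rw [Finset.sum_eq_single (⟨a, a.2.trans_le hp⟩ : Fin d)]
  · simp
  · intro i _ hi
    have : ¬ (i : ℕ) = a := fun h => hi (Fin.ext h)
    simp [this]
  · simp

lemma PiBlock_self (p : ℕ) : PiBlock p p = 1 := by
  ext a b
  simp [PiBlock, Matrix.one_apply, Fin.ext_iff]

/-- `G` with `Gᵀ G = Σ_m` and `G Gᵀ = diag μ`. -/
lemma exists_G {p q : ℕ} (S₁ : Matrix (Fin p) (Fin p) ℝ) (S₂ : Matrix (Fin q) (Fin q) ℝ)
    (U₁ : Matrix (Fin p) (Fin p) ℝ) (l1 : Fin p → ℝ)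
    (U₂ : Matrix (Fin q) (Fin q) ℝ) (l2 : Fin q → ℝ)
    (h10 : ∀ i, 0 ≤ l1 i) (h20 : ∀ i, 0 ≤ l2 i)
    (hU₁ : U₁ᵀ * U₁ = 1) (hU₂ : U₂ᵀ * U₂ = 1)
    (hdec1 : S₁ = U₁ * Matrix.diagonal l1 * U₁ᵀ)
    (hdec2 : S₂ = U₂ * Matrix.diagonal l2 * U₂ᵀ) :
    ∃ G : Matrix (Fin (p + q)) (Fin (p + q)) ℝ,
      Gᵀ * G = blockMat S₁ (PsiM U₁ l1 U₂ l2) S₂ ∧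
      G * Gᵀ = Matrix.diagonal (fun k : Fin (p + q) => extZ l1 k + extZ l2 k) := by
  set r1 := Matrix.diagonal (fun i => Real.sqrt (l1 i)) with hr1
  set r2 := Matrix.diagonal (fun i => Real.sqrt (l2 i)) with hr2
  have e1 : r1 * r1 = Matrix.diagonal l1 := by
    simp [hr1, Matrix.diagonal_mul_diagonal, Real.mul_self_sqrt, h10]
  have e2 : r2 * r2 = Matrix.diagonal l2 := by
    simp [hr2, Matrix.diagonal_mul_diagonal, Real.mul_self_sqrt, h20]
  have t1 : r1ᵀ = r1 := by simp [hr1]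
  have t2 : r2ᵀ = r2 := by simp [hr2]
  set A := PiBlock (p + q) p * r1 * U₁ᵀ with hA
  set B := PiBlock (p + q) q * r2 * U₂ᵀ with hB
  have AA : Aᵀ * A = S₁ := by
    calc Aᵀ * A = U₁ * (r1 * ((PiBlock (p + q) p)ᵀ * PiBlock (p + q) p) * r1) * U₁ᵀ := by
          simp only [hA, Matrix.transpose_mul, Matrix.transpose_transpose, t1, Matrix.mul_assoc]
      _ = S₁ := by rw [PiBlock_mul (by omega), PiBlock_self, Matrix.mul_one, e1, hdec1]
  have BB : Bᵀ * B = S₂ := by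
    calc Bᵀ * B = U₂ * (r2 * ((PiBlock (p + q) q)ᵀ * PiBlock (p + q) q) * r2) * U₂ᵀ := by
          simp only [hB, Matrix.transpose_mul, Matrix.transpose_transpose, t2, Matrix.mul_assoc]
      _ = S₂ := by rw [PiBlock_mul (by omega), PiBlock_self, Matrix.mul_one, e2, hdec2]
  have AB : Aᵀ * B = PsiM U₁ l1 U₂ l2 := by
    calc Aᵀ * B = U₁ * r1 * ((PiBlock (p + q) p)ᵀ * PiBlock (p + q) q) * r2 * U₂ᵀ := by
          simp only [hA, hB, Matrix.transpose_mul, Matrix.transpose_transpose, t1, Matrix.mul_assoc]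
      _ = _ := by rw [PiBlock_mul (by omega)]; rfl
  have BA : Bᵀ * A = (PsiM U₁ l1 U₂ l2)ᵀ := by
    rw [← AB, Matrix.transpose_mul Aᵀ B, Matrix.transpose_transpose A]
  have A' : A * Aᵀ = Matrix.diagonal (fun k : Fin (p + q) => extZ l1 k) := by
    rw [← PiBlock_sq, ← e1]
    calc A * Aᵀ = PiBlock (p + q) p * (r1 * (U₁ᵀ * U₁) * r1) * (PiBlock (p + q) p)ᵀ := by
          simp only [hA, Matrix.transpose_mul, Matrix.transpose_transpose, t1, Matrix.mul_assoc]
      _ = _ := by rw [hU₁, Matrix.mul_one]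
  have B' : B * Bᵀ = Matrix.diagonal (fun k : Fin (p + q) => extZ l2 k) := by
    rw [← PiBlock_sq, ← e2]
    calc B * Bᵀ = PiBlock (p + q) q * (r2 * (U₂ᵀ * U₂) * r2) * (PiBlock (p + q) q)ᵀ := by
          simp only [hB, Matrix.transpose_mul, Matrix.transpose_transpose, t2, Matrix.mul_assoc]
      _ = _ := by rw [hU₂, Matrix.mul_one]
  refine ⟨(Matrix.fromCols A B).submatrix id finSumFinEquiv.symm, ?_, ?_⟩
  · rw [Matrix.transpose_submatrix, blockMat, ← AA, ← BB, ← BA, ← AB]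
    rw [← Matrix.submatrix_mul _ _ _ id _ Function.bijective_id, Matrix.transpose_fromCols,
      Matrix.fromRows_mul_fromCols]
  · rw [Matrix.transpose_submatrix,
      Matrix.submatrix_mul_equiv, Matrix.transpose_fromCols, Matrix.fromCols_mul_fromRows, A', B',
      Matrix.diagonal_add]
    simp

lemma sum_eigenvalues_eq {d : ℕ} (S : Matrix (Fin d) (Fin d) ℝ) (hS : S.IsHermitian)
    (mu : Fin d → ℝ) (G : Matrix (Fin d) (Fin d) ℝ) (h1 : Gᵀ * G = S)
    (h2 : G * Gᵀ = Matrix.diagonal mu) (f : ℝ → ℝ) :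
    ∑ k, f (hS.eigenvalues k) = ∑ k, f (mu k) := by
  have h := hS.charpoly_eq
  have h3 : S.charpoly = ∏ k, (Polynomial.X - Polynomial.C (mu k)) := by
    rw [← h1, Matrix.charpoly_mul_comm, h2, Matrix.charpoly_diagonal]
  rw [h3] at h
  have key : ∀ g : Fin d → ℝ, (∏ k, (Polynomial.X - Polynomial.C (g k))).roots
      = Finset.univ.val.map g := by
    intro g
    have := Polynomial.roots_multiset_prod_X_sub_C (Finset.univ.val.map g)
    rwa [Multiset.map_map] at this
  have h5 := congrArg Polynomial.roots h
  rw [key] at h5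
  have h6 : Finset.univ.val.map mu = Finset.univ.val.map hS.eigenvalues := by
    rw [h5, ← key]; rfl
  have h7 := congrArg (fun m => (m.map f).sum) h6
  simp only [Multiset.map_map] at h7
  exact h7.symm

lemma exists_C {d : ℕ} (S : Matrix (Fin d) (Fin d) ℝ) (hS : S.PosSemidef) :
    ∃ (C : Matrix (Fin d) (Fin d) ℝ) (lam : Fin d → ℝ), Antitone lam ∧ (∀ k, 0 ≤ lam k) ∧
      Cᵀ * C = S ∧ C * Cᵀ = Matrix.diagonal lam ∧
      ∀ f : ℝ → ℝ, ∑ k, f (hS.isHermitian.eigenvalues k) = ∑ k, f (lam k) := by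
  set ev := hS.isHermitian.eigenvalues with hev
  have ev0 : ∀ k, 0 ≤ ev k := fun k => hS.eigenvalues_nonneg k
  let V : Matrix (Fin d) (Fin d) ℝ := hS.isHermitian.eigenvectorUnitary
  have hV : Vᵀ * V = 1 := by
    have := Unitary.coe_star_mul_self hS.isHermitian.eigenvectorUnitary
    simpa [Matrix.star_eq_conjTranspose] using this
  have hsp : S = V * Matrix.diagonal ev * Vᵀ := by
    have := hS.isHermitian.spectral_theorem
    rw [Unitary.conjStarAlgAut_apply] at this
    simpa [Matrix.star_eq_conjTranspose] using this
  let r := Matrix.diagonal (fun k => Real.sqrt (ev k))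
  have hr : r * r = Matrix.diagonal ev := by
    simp [r, Matrix.diagonal_mul_diagonal, Real.mul_self_sqrt, ev0]
  have tr : rᵀ = r := by simp [r]
  let σ := Tuple.sort (fun k => - ev k)
  have hσ : Antitone (ev ∘ σ) := by
    have := Tuple.monotone_sort (fun k => - ev k)
    intro a b hab
    have := this hab
    simpa [σ] using this
  refine ⟨(r * Vᵀ).submatrix σ id, ev ∘ σ, hσ, fun k => ev0 _, ?_, ?_, ?_⟩
  · rw [Matrix.transpose_submatrix, Matrix.submatrix_mul_equiv, Matrix.submatrix_id_id,
      Matrix.transpose_mul, Matrix.transpose_transpose, tr, hsp, ← hr]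
    simp only [Matrix.mul_assoc]
  · rw [Matrix.transpose_submatrix, ← Matrix.submatrix_mul _ _ _ id _ Function.bijective_id,
      Matrix.transpose_mul, Matrix.transpose_transpose, tr]
    have : r * Vᵀ * (V * r) = Matrix.diagonal ev := by
      rw [Matrix.mul_assoc, ← Matrix.mul_assoc Vᵀ, hV, Matrix.one_mul, hr]
    rw [this, Matrix.submatrix_diagonal_equiv]
  · intro f
    exact (Equiv.sum_comp σ (fun k => f (ev k))).symm

/-- among matrices in `Γ(Σ₁, Σ₂)`, the matrix `Σ_m` minimizes the
von Neumann entropy `−trace(Σ log Σ) = −∑_j λ_j log λ_j`. -/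
theorem SigmaM_minimizes_vonNeumannEntropy {p q : ℕ}
    (S₁ : Matrix (Fin p) (Fin p) ℝ) (S₂ : Matrix (Fin q) (Fin q) ℝ)
    (hS₁ : S₁.PosSemidef) (hS₂ : S₂.PosSemidef)
    (U₁ : Matrix (Fin p) (Fin p) ℝ) (l1 : Fin p → ℝ)
    (U₂ : Matrix (Fin q) (Fin q) ℝ) (l2 : Fin q → ℝ)
    (hU₁ : U₁ * U₁ᵀ = 1) (hU₂ : U₂ * U₂ᵀ = 1)
    (hl1 : Antitone l1) (hl2 : Antitone l2)
    (hdec1 : S₁ = U₁ * Matrix.diagonal l1 * U₁ᵀ)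
    (hdec2 : S₂ = U₂ * Matrix.diagonal l2 * U₂ᵀ) :
    (blockMat S₁ (PsiM U₁ l1 U₂ l2) S₂).PosSemidef ∧
    ∀ (hSm : (blockMat S₁ (PsiM U₁ l1 U₂ l2) S₂).IsHermitian)
      (Ψ : Matrix (Fin p) (Fin q) ℝ) (hΨ : (blockMat S₁ Ψ S₂).PosSemidef),
      vonNeumannEntropy _ hSm ≤ vonNeumannEntropy _ hΨ.isHermitian := by
  have hU₁' : U₁ᵀ * U₁ = 1 := mul_eq_one_comm.1 hU₁
  have hU₂' : U₂ᵀ * U₂ = 1 := mul_eq_one_comm.1 hU₂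
  have conj1 : U₁ᵀ * S₁ * U₁ = Matrix.diagonal l1 := by
    rw [hdec1]
    calc _ = (U₁ᵀ * U₁) * Matrix.diagonal l1 * (U₁ᵀ * U₁) := by simp only [Matrix.mul_assoc]
      _ = _ := by rw [hU₁', Matrix.one_mul, Matrix.mul_one]
  have conj2 : U₂ᵀ * S₂ * U₂ = Matrix.diagonal l2 := by
    rw [hdec2]
    calc _ = (U₂ᵀ * U₂) * Matrix.diagonal l2 * (U₂ᵀ * U₂) := by simp only [Matrix.mul_assoc]
      _ = _ := by rw [hU₂', Matrix.one_mul, Matrix.mul_one]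
  have h10 : ∀ i, 0 ≤ l1 i := by
    have := hS₁.conjTranspose_mul_mul_same U₁
    rw [Matrix.conjTranspose_eq_transpose_of_trivial, conj1] at this
    exact Matrix.posSemidef_diagonal_iff.1 this
  have h20 : ∀ i, 0 ≤ l2 i := by
    have := hS₂.conjTranspose_mul_mul_same U₂
    rw [Matrix.conjTranspose_eq_transpose_of_trivial, conj2] at this
    exact Matrix.posSemidef_diagonal_iff.1 this
  obtain ⟨G, hG1, hG2⟩ := exists_G S₁ S₂ U₁ l1 U₂ l2 h10 h20 hU₁' hU₂' hdec1 hdec2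
  refine ⟨?_, ?_⟩
  · rw [← hG1, ← Matrix.conjTranspose_eq_transpose_of_trivial]
    exact Matrix.posSemidef_conjTranspose_mul_self G
  intro hSm Ψ hΨ
  unfold vonNeumannEntropy
  rw [neg_le_neg_iff, sum_eigenvalues_eq _ hSm _ G hG1 hG2 (fun x => x * Real.log x)]
  obtain ⟨C, lam, hlam, hlam0, hC1, hC2, hf⟩ := exists_C _ hΨ
  rw [hf (fun x => x * Real.log x)]
  let A0 : Matrix (Fin (p + q)) (Fin p) ℝ := C.submatrix id (Fin.castAdd q)
  let B0 : Matrix (Fin (p + q)) (Fin q) ℝ := C.submatrix id (Fin.natAdd p)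
  have hA0 : A0ᵀ * A0 = S₁ := by
    ext i j
    have := congrFun (congrFun hC1 (Fin.castAdd q i)) (Fin.castAdd q j)
    simpa [A0, Matrix.mul_apply, blockMat] using this
  have hB0 : B0ᵀ * B0 = S₂ := by
    ext i j
    have := congrFun (congrFun hC1 (Fin.natAdd p i)) (Fin.natAdd p j)
    simpa [B0, Matrix.mul_apply, blockMat] using this
  have hAB : A0 * A0ᵀ + B0 * B0ᵀ = Matrix.diagonal lam := by
    rw [← hC2]
    ext i j
    simp [A0, B0, Matrix.mul_apply, Fin.sum_univ_add]
  have hA : (A0 * U₁)ᵀ * (A0 * U₁) = Matrix.diagonal l1 := by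
    rw [← conj1, ← hA0, Matrix.transpose_mul]
    simp only [Matrix.mul_assoc]
  have hB : (B0 * U₂)ᵀ * (B0 * U₂) = Matrix.diagonal l2 := by
    rw [← conj2, ← hB0, Matrix.transpose_mul]
    simp only [Matrix.mul_assoc]
  have hAB' : (A0 * U₁) * (A0 * U₁)ᵀ + (B0 * U₂) * (B0 * U₂)ᵀ = Matrix.diagonal lam := by
    rw [← hAB, Matrix.transpose_mul, Matrix.transpose_mul, Matrix.mul_assoc A0,
      ← Matrix.mul_assoc U₁, hU₁, Matrix.one_mul, Matrix.mul_assoc B0,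
      ← Matrix.mul_assoc U₂, hU₂, Matrix.one_mul]
  obtain ⟨W1, hW1, hr1, hc1, hw1⟩ := weights _ l1 h10 hA
  obtain ⟨W2, hW2, hr2, hc2, hw2⟩ := weights _ l2 h20 hB
  have hlamk : ∀ k, lam k = ∑ i, W1 k i * l1 i + ∑ j, W2 k j * l2 j := by
    intro k
    have := congrFun (congrFun hAB' k) k
    rw [Matrix.diagonal_apply_eq, Matrix.add_apply, Matrix.mul_apply, Matrix.mul_apply] at this
    simp only [hw1, hw2]
    rw [← this]
    simp only [Matrix.transpose_apply, sq]
  refine karamata lam _ hlam hlam0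
    (fun k => add_nonneg (extZ_nonneg h10 _) (extZ_nonneg h20 _)) ?_ ?_
  · rw [Finset.sum_add_distrib, sum_extZ (by omega), sum_extZ (by omega)]
    have := congrArg Matrix.trace hAB'
    rw [Matrix.trace_add, Matrix.trace_mul_comm, hA, Matrix.trace_mul_comm, hB] at this
    simpa [Matrix.trace_diagonal] using this.symm
  · intro c hc hc0
    simp only [hlamk, mul_add, Finset.sum_add_distrib]
    exact add_le_add (substoch (by omega) c l1 hc hl1 hc0 h10 W1 hW1 hr1 hc1)
      (substoch (by omega) c l2 hc hl2 hc0 h20 W2 hW2 hr2 hc2)
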